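/- arXiv:2501.10299 — 8 statements merged into one kernel-verified Lean document; each statement's English description precedes it below -/
import Mathlib

section
/- Let n ≥ 1 and L ≥ n+1 be natural numbers, and let θ_1, …, θ_L be unit vectors in ℝ² that are pairwise non-collinear (i.e., for all distinct l, k ≤ L, θ_l and θ_k are linearly independent). Let x, y : Fin n → ℝ² be two tuples of points. If for every l = 1, …, L the multiset of projections {⟪θ_l, x_i⟫ : i = 1, …, n} equals the multiset {⟪θ_l, y_i⟫ : i = 1, …, n}, then the multiset {x_1, …, x_n} equals the multiset {y_1, …, y_n}. (Injectivity part of Proposition 1: the map Proj_θ is injective on uniform discrete measures with n atoms.) -/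
open Real Finset
open scoped RealInnerProductSpace

noncomputable section

/-- A multiset with fewer elements than there are maps `f l` is determined by its images under
the `f l`, provided any two of these maps jointly separate points. -/
theorem Multiset.eq_of_forall_map_eq_of_card_lt {ι α β : Type*} [Fintype ι] (f : ι → α → β)
    (hf : ∀ l k, l ≠ k → ∀ a b, f l a = f l b → f k a = f k b → a = b)
    (s t : Multiset α) (hs : s.card < Fintype.card ι)
    (h : ∀ l, s.map (f l) = t.map (f l)) : s = t := by
  classical
  induction s using Multiset.induction_on generalizing t with
  | empty =>
    obtain ⟨l⟩ := Fintype.card_pos_iff.mp (Nat.zero_lt_of_lt hs)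
    exact (Multiset.map_eq_zero.mp (h l).symm).symm
  | cons a s ih =>
    obtain ⟨l₀⟩ := Fintype.card_pos_iff.mp (Nat.zero_lt_of_lt hs)
    have hcard : (a ::ₘ s).card = t.card := by
      simpa only [Multiset.card_map] using congrArg Multiset.card (h l₀)
    have hmem : ∀ l, ∃ b ∈ t, f l b = f l a := fun l =>
      Multiset.mem_map.mp (h l ▸ Multiset.mem_map_of_mem (f l) (Multiset.mem_cons_self a s))
    choose b hbt hb using hmem
    obtain ⟨l, -, k, -, hlk, hbe⟩ := Finset.exists_ne_map_eq_of_card_lt_of_maps_to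
      (s := Finset.univ) (t := t.toFinset) (f := b)
      ((Multiset.toFinset_card_le t).trans_lt (hcard ▸ hs))
      (fun l _ => Multiset.mem_toFinset.mpr (hbt l))
    have hab : b l = a := hf l k hlk _ _ (hb l) (hbe ▸ hb k)
    obtain ⟨t, rfl⟩ := Multiset.exists_cons_of_mem (hab ▸ hbt l)
    rw [ih t ((Multiset.card_lt_card (Multiset.lt_cons_self s a)).trans hs) fun l => by
      simpa only [Multiset.map_cons, Multiset.cons_inj_right] using h l]

/-- A vector of a two-dimensional inner product space is determined by its inner products with
two linearly independent vectors. -/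
theorem LinearIndependent.eq_of_inner_eq {E : Type*} [NormedAddCommGroup E]
    [InnerProductSpace ℝ E] (hE : Module.finrank ℝ E = 2) {u v : E}
    (h : LinearIndependent ℝ ![u, v]) {a b : E}
    (hu : ⟪u, a⟫ = ⟪u, b⟫) (hv : ⟪v, a⟫ = ⟪v, b⟫) : a = b := by
  let B := basisOfLinearIndependentOfCardEqFinrank h (by simp [hE])
  refine InnerProductSpace.ext_inner_left_basis B fun i => ?_
  fin_cases i <;> simpa [B]

/-- Injectivity part of Proposition 1: if all multisets of one-dimensional projections
along `L ≥ n+1` pairwise non-collinear unit directions coincide, then the two uniform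
discrete measures (multisets of atoms) coincide. -/
theorem proj_theta_injective
    (n L : ℕ) (hn : 1 ≤ n) (hL : n + 1 ≤ L)
    (θ : Fin L → EuclideanSpace ℝ (Fin 2))
    (hunit : ∀ l : Fin L, ‖θ l‖ = 1)
    (hncol : ∀ l k : Fin L, l ≠ k → LinearIndependent ℝ ![θ l, θ k])
    (x y : Fin n → EuclideanSpace ℝ (Fin 2))
    (hproj : ∀ l : Fin L,
      Multiset.map (fun i => ⟪θ l, x i⟫) Finset.univ.val =
      Multiset.map (fun i => ⟪θ l, y i⟫) Finset.univ.val) :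
    Multiset.map x Finset.univ.val = Multiset.map y Finset.univ.val := by
  refine Multiset.eq_of_forall_map_eq_of_card_lt (fun l a => ⟪θ l, a⟫)
    (fun l k hlk a b => (hncol l k hlk).eq_of_inner_eq (by simp)) _ _ ?_ fun l => ?_
  · simpa using hL
  · simpa only [Multiset.map_map, Function.comp_def] using hproj l
end
end

section
/- Let n ≥ 1, let θ_1, …, θ_L be vectors in ℝ², and let p ≥ 1 be a real number. For tuples x, y : Fin n → ℝ², the discrete sliced-Wasserstein quantity ŜW_p(x, y) = ( (1/L) Σ_{l=1}^L min_{σ ∈ S_n} (1/n) Σ_{i=1}^n |⟪θ_l, x_i⟫ − ⟪θ_l, y_{σ(i)}⟫|^p )^{1/p} equals (1/(nL))^{1/p} · ( Σ_{l=1}^L Σ_{i=1}^n | (⟪θ_l, x⟫)_{(i)} − (⟪θ_l, y⟫)_{(i)} |^p )^{1/p}, where for a tuple a : Fin n → ℝ, a_{(1)} ≤ … ≤ a_{(n)} denotes its monotone (sorted) rearrangement, and ⟪θ_l, x⟫ denotes the tuple i ↦ ⟪θ_l, x_i⟫. In other words, the embedding Proj_θ sending x to the n×L matrix of sorted projections ((⟪θ_l,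 x⟫)_{(i)})_{i≤n, l≤L} preserves the sliced-Wasserstein distance, which coincides with the normalized ℓ^p distance (1/(nL))^{1/p}‖·‖_p between embeddings. (Distance-preservation part of Proposition 1.) -/
open Real Finset
open scoped RealInnerProductSpace

noncomputable section

/-- The sorted (monotone nondecreasing) rearrangement of a real tuple. -/
noncomputable def sortedTuple {n : ℕ} (a : Fin n → ℝ) : Fin n → ℝ :=
  a ∘ Tuple.sort a

/-- Uncrossing two pairs does not increase a convex cost of the differences. -/
theorem ConvexOn.map_sub_add_map_sub_le {c : ℝ → ℝ} (hc : ConvexOn ℝ Set.univ c)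
    {a a' b b' : ℝ} (ha : a ≤ a') (hb : b ≤ b') :
    c (a - b) + c (a' - b') ≤ c (a - b') + c (a' - b) := by
  rcases ha.eq_or_lt with rfl | ha
  · exact (add_comm _ _).le
  have hD : 0 < (a' - a) + (b' - b) := by linarith
  set D := (a' - a) + (b' - b) with hD'
  have hs : 0 ≤ (a' - a) / D := div_nonneg (by linarith) hD.le
  have ht : 0 ≤ (b' - b) / D := div_nonneg (by linarith) hD.le
  have hst : (a' - a) / D + (b' - b) / D = 1 := by rw [← add_div, ← hD', div_self hD.ne']
  have h₁ := hc.2 (Set.mem_univ (a - b')) (Set.mem_univ (a' - b)) hs ht hst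
  have h₂ := hc.2 (Set.mem_univ (a - b')) (Set.mem_univ (a' - b)) ht hs (by rw [add_comm, hst])
  have e₁ : (a' - a) / D * (a - b') + (b' - b) / D * (a' - b) = a - b := by
    field_simp
    rw [hD']
    ring
  have e₂ : (b' - b) / D * (a - b') + (a' - a) / D * (a' - b) = a' - b' := by
    field_simp
    rw [hD']
    ring
  simp only [smul_eq_mul] at h₁ h₂
  rw [e₁] at h₁
  rw [e₂] at h₂
  linear_combination h₁ + h₂ + (c (a - b') + c (a' - b)) * hst

/-- A convex cost of the differences of two monotone tuples is minimized by the identity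
permutation. -/
theorem ConvexOn.sum_map_sub_le_sum_map_sub_comp_perm {ι : Type*} [LinearOrder ι] {c : ℝ → ℝ}
    (hc : ConvexOn ℝ Set.univ c) {f g : ι → ℝ} (hf : Monotone f) (hg : Monotone g)
    {s : Finset ι} {σ : Equiv.Perm ι} (hσ : {x | σ x ≠ x} ⊆ s) :
    ∑ i ∈ s, c (f i - g i) ≤ ∑ i ∈ s, c (f i - g (σ i)) := by
  induction s using Finset.induction_on_max generalizing σ with
  | empty => simp
  | insert a s hmax hind =>
    have has : a ∉ s := fun h => (hmax a h).false
    set τ : Equiv.Perm ι := σ.trans (Equiv.swap a (σ a)) with hτ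
    have hτs : {x | τ x ≠ x} ⊆ s := by
      intro x hx
      simp only [τ, Ne, Set.mem_ofPred_eq, Equiv.swap_comp_apply] at hx
      split_ifs at hx with h₁ h₂
      · obtain rfl | hax := eq_or_ne x a
        · contradiction
        · exact mem_of_mem_insert_of_ne (hσ fun h => hax <| h.symm.trans h₁) hax
      · exact (hx <| σ.injective h₂.symm).elim
      · exact mem_of_mem_insert_of_ne (hσ hx) (ne_of_apply_ne _ h₂)
    specialize hind hτs
    simp_rw [sum_insert has]
    refine (add_le_add_right hind _).trans ?_
    obtain hσa | hσa := eq_or_ne a (σ a)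
    · rw [hτ, ← hσa, Equiv.swap_self, Equiv.trans_refl]
    have h1s : σ.symm a ∈ s := by
      have hne : σ.symm a ≠ a := fun h => hσa ((Equiv.symm_apply_eq σ).1 h)
      refine mem_of_mem_insert_of_ne (hσ fun h => hne ?_) hne
      rwa [Equiv.apply_symm_apply, eq_comm] at h
    have h2s : σ a ∈ s :=
      mem_of_mem_insert_of_ne (hσ <| σ.injective.ne hσa.symm) hσa.symm
    have hrest : ∑ x ∈ s.erase (σ.symm a), c (f x - g (τ x)) =
        ∑ x ∈ s.erase (σ.symm a), c (f x - g (σ x)) := by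
      refine sum_congr rfl fun x hx => ?_
      rw [mem_erase, Ne, Equiv.eq_symm_apply] at hx
      rw [hτ, Equiv.trans_apply, Equiv.swap_apply_of_ne_of_ne hx.1 (σ.injective.ne _)]
      rintro rfl
      exact has hx.2
    rw [← s.sum_erase_add _ h1s, ← s.sum_erase_add _ h1s, hrest]
    have key := hc.map_sub_add_map_sub_le (hf (hmax _ h1s).le) (hg (hmax _ h2s).le)
    have hτa : τ (σ.symm a) = σ a := by simp [hτ]
    rw [hτa, Equiv.apply_symm_apply]
    linarith

theorem convexOn_abs_rpow {p : ℝ} (hp : 1 ≤ p) :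
    ConvexOn ℝ Set.univ fun x : ℝ => |x| ^ p := by
  refine ⟨convex_univ, fun x _ y _ a b ha hb hab => ?_⟩
  refine le_trans ?_
    ((convexOn_rpow hp).2 (Set.mem_Ici.2 (abs_nonneg x)) (Set.mem_Ici.2 (abs_nonneg y)) ha hb hab)
  refine Real.rpow_le_rpow (abs_nonneg _) ?_ (by linarith)
  exact (convexOn_norm (E := ℝ) convex_univ).2 (Set.mem_univ x) (Set.mem_univ y) ha hb hab

/-- The optimal assignment cost between two real tuples, for a convex cost of the differences,
is attained by matching their sorted rearrangements. -/
theorem ConvexOn.iInf_perm_mul_sum_eq_sortedTuple {n : ℕ} {c : ℝ → ℝ}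
    (hc : ConvexOn ℝ Set.univ c) {r : ℝ} (hr : 0 ≤ r) (a b : Fin n → ℝ) :
    ⨅ σ : Equiv.Perm (Fin n), r * ∑ i, c (a i - b (σ i)) =
      r * ∑ i, c (sortedTuple a i - sortedTuple b i) := by
  apply le_antisymm
  · refine (ciInf_le (Set.finite_range _).bddBelow
      ((Tuple.sort a).symm.trans (Tuple.sort b))).trans_eq ?_
    rw [← Equiv.sum_comp (Tuple.sort a)]
    simp [sortedTuple]
  · refine le_ciInf fun σ => mul_le_mul_of_nonneg_left ?_ hr
    refine (hc.sum_map_sub_le_sum_map_sub_comp_perm (Tuple.monotone_sort a)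
      (Tuple.monotone_sort b)
      (σ := ((Tuple.sort a).trans σ).trans (Tuple.sort b).symm) (by simp)).trans_eq ?_
    rw [← Equiv.sum_comp (Tuple.sort a) fun i => c (a i - b (σ i))]
    simp

/-- Distance-preservation part of Proposition 1: the discrete sliced-Wasserstein quantity
equals the normalized ℓ^p distance between the matrices of sorted projections. -/
theorem proj_theta_preserves_sliced_wasserstein
    (n L : ℕ) (hn : 1 ≤ n)
    (θ : Fin L → EuclideanSpace ℝ (Fin 2)) (p : ℝ) (hp : 1 ≤ p)
    (x y : Fin n → EuclideanSpace ℝ (Fin 2)) :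
    ((1 / (L : ℝ)) * ∑ l : Fin L, ⨅ σ : Equiv.Perm (Fin n),
        (1 / (n : ℝ)) * ∑ i : Fin n, |⟪θ l, x i⟫ - ⟪θ l, y (σ i)⟫| ^ p) ^ (1 / p)
      = (1 / ((n : ℝ) * (L : ℝ))) ^ (1 / p) *
        (∑ l : Fin L, ∑ i : Fin n,
          |sortedTuple (fun j => ⟪θ l, x j⟫) i -
            sortedTuple (fun j => ⟪θ l, y j⟫) i| ^ p) ^ (1 / p) := by
  have h (l : Fin L) := (convexOn_abs_rpow hp).iInf_perm_mul_sum_eq_sortedTuple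
    (r := 1 / (n : ℝ)) (by positivity) (fun j => ⟪θ l, x j⟫) (fun j => ⟪θ l, y j⟫)
  simp only [h]
  rw [← Finset.mul_sum, ← mul_assoc, one_div_mul_one_div, mul_comm (L : ℝ),
    Real.mul_rpow (by positivity) (by positivity)]
end
end

section
/- Let n ≥ 1, L ≥ n+1, let θ_1, …, θ_L be pairwise non-collinear unit vectors in ℝ², and let p ≥ 1 be a real number. Define, for tuples x, y : Fin n → ℝ², d(x, y) = ( (1/L) Σ_{l=1}^L min_{σ ∈ S_n} (1/n) Σ_{i=1}^n |⟪θ_l, x_i⟫ − ⟪θ_l, y_{σ(i)}⟫|^p )^{1/p}. Then d is nonnegative, symmetric, satisfies the triangle inequality d(x, z) ≤ d(x, y) + d(y, z) for all tuples x, y, z, and d(x, y) = 0 if and only if the multisets {x_1, …, x_n} and {y_1, …, y_n} coincide. (Proposition 1: ŜW_p(·,·,(θ_l)_{l≤L}) is a distance on the space of uniform discrete measures with n atoms in ℝ².) -/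
open Real Finset
open scoped RealInnerProductSpace

noncomputable section

/-- The discrete sliced-Wasserstein quantity of order `p` along the directions `θ`,
between the uniform discrete measures represented by the tuples `x` and `y`. -/
noncomputable def slicedW (n L : ℕ) (θ : Fin L → EuclideanSpace ℝ (Fin 2)) (p : ℝ)
    (x y : Fin n → EuclideanSpace ℝ (Fin 2)) : ℝ :=
  ((1 / (L : ℝ)) * ∑ l : Fin L, ⨅ σ : Equiv.Perm (Fin n),
      (1 / (n : ℝ)) * ∑ i : Fin n, |⟪θ l, x i⟫ - ⟪θ l, y (σ i)⟫| ^ p) ^ (1 / p)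

theorem Multiset.eq_of_forall_map_eq {ι α β : Type*} [Fintype ι] (f : ι → α → β)
    (hf : ∀ l k : ι, l ≠ k → ∀ a b : α, f l a = f l b → f k a = f k b → a = b)
    (s t : Multiset α) (hs : card s < Fintype.card ι) (h : ∀ l, s.map (f l) = t.map (f l)) :
    s = t := by
  classical
  induction s using Multiset.induction_on generalizing t with
  | empty =>
    obtain ⟨l⟩ : Nonempty ι := Fintype.card_pos_iff.mp (Nat.zero_lt_of_lt hs)
    exact (Multiset.map_eq_zero.mp (h l).symm).symm
  | cons a s ih =>
    have hex : ∀ l, ∃ b ∈ t, f l b = f l a := fun l => by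
      rw [← Multiset.mem_map, ← h l]
      exact Multiset.mem_map_of_mem _ (Multiset.mem_cons_self a s)
    choose g hgt hg using hex
    have hcard : card t < Fintype.card ι := by
      obtain ⟨l⟩ : Nonempty ι := Fintype.card_pos_iff.mp (Nat.zero_lt_of_lt hs)
      rwa [← Multiset.card_map (f l) t, ← h l, Multiset.card_map]
    obtain ⟨l, -, k, -, hlk, heq⟩ :=
      Finset.exists_ne_map_eq_of_card_lt_of_maps_to (s := Finset.univ) (t := t.toFinset) (f := g)
        ((Multiset.toFinset_card_le t).trans_lt hcard)
        (fun l _ => Multiset.mem_toFinset.mpr (hgt l))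
    have hga : g l = a := hf l k hlk _ _ (hg l) (heq ▸ hg k)
    obtain ⟨u, rfl⟩ := Multiset.exists_cons_of_mem (hga ▸ hgt l)
    rw [ih u ((Nat.lt_succ_self _).trans (by simpa using hs)) fun j => by simpa using h j]

theorem Multiset.map_univ_val_eq_iff_exists_perm {ι α : Type*} [Fintype ι] (x y : ι → α) :
    Multiset.map x Finset.univ.val = Multiset.map y Finset.univ.val ↔
      ∃ σ : Equiv.Perm ι, ∀ i, x i = y (σ i) := by
  classical
  constructor
  · intro h
    have hcard : ∀ c, Nonempty ({i // x i = c} ≃ {i // y i = c}) := fun c => by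
      rw [← Fintype.card_eq, Fintype.card_subtype, Fintype.card_subtype]
      simpa [Multiset.count_map, Finset.card_def, eq_comm] using congrArg (Multiset.count c) h
    exact ⟨Equiv.ofFiberEquiv fun c => (hcard c).some,
      fun i => (Equiv.ofFiberEquiv_map _ i).symm⟩
  · rintro ⟨σ, h⟩
    rw [funext h, ← Function.comp_def y σ, ← Multiset.map_map, Multiset.map_univ_val_equiv]

theorem eq_of_inner_eq_of_linearIndependent {u v a b : EuclideanSpace ℝ (Fin 2)}
    (huv : LinearIndependent ℝ ![u, v]) (hu : ⟪u, a⟫ = ⟪u, b⟫) (hv : ⟪v, a⟫ = ⟪v, b⟫) :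
    a = b := by
  have hspan : ⊤ ≤ Submodule.span ℝ (Set.range ![u, v]) :=
    (huv.span_eq_top_of_card_eq_finrank' (by simp)).ge
  refine ext_inner_left ℝ fun w => ?_
  induction hspan (Submodule.mem_top (x := w)) using Submodule.span_induction with
  | mem w hw =>
    obtain ⟨i, rfl⟩ := hw
    fin_cases i <;> simpa
  | zero => simp
  | add v w _ _ hv hw => rw [inner_add_left, inner_add_left, hv, hw]
  | smul c w _ hw => rw [real_inner_smul_left, real_inner_smul_left, hw]

/-- The transport cost of matching `x i` with `y (σ l i)` along each direction `θ l`. -/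
def slicedCost {n L : ℕ} (θ : Fin L → EuclideanSpace ℝ (Fin 2)) (p : ℝ)
    (x y : Fin n → EuclideanSpace ℝ (Fin 2)) (σ : Fin L → Equiv.Perm (Fin n)) : ℝ :=
  ∑ j : Fin L × Fin n, |⟪θ j.1, x j.2⟫ - ⟪θ j.1, y (σ j.1 j.2)⟫| ^ p

section slicedW

variable {n L : ℕ} (θ : Fin L → EuclideanSpace ℝ (Fin 2)) (p : ℝ)
  (x y z : Fin n → EuclideanSpace ℝ (Fin 2))

theorem slicedCost_nonneg (σ : Fin L → Equiv.Perm (Fin n)) : 0 ≤ slicedCost θ p x y σ :=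
  Finset.sum_nonneg fun _ _ => by positivity

theorem slicedCost_eq_zero_iff {p : ℝ} (hp : p ≠ 0) (σ : Fin L → Equiv.Perm (Fin n)) :
    slicedCost θ p x y σ = 0 ↔ ∀ l i, ⟪θ l, x i⟫ = ⟪θ l, y (σ l i)⟫ := by
  rw [slicedCost, Finset.sum_eq_zero_iff_of_nonneg fun _ _ => by positivity]
  simp [hp, sub_eq_zero]

theorem mean_slicedCost_eq (σ : Fin L → Equiv.Perm (Fin n)) :
    1 / (L : ℝ) * (1 / (n : ℝ)) * slicedCost θ p x y σ = 1 / (L : ℝ) * ∑ l : Fin L,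
      1 / (n : ℝ) * ∑ i : Fin n, |⟪θ l, x i⟫ - ⟪θ l, y (σ l i)⟫| ^ p := by
  rw [slicedCost, Fintype.sum_prod_type, mul_assoc, Finset.mul_sum (a := 1 / (n : ℝ))]

theorem slicedW_le_slicedCost {p : ℝ} (hp : 0 ≤ p) (σ : Fin L → Equiv.Perm (Fin n)) :
    slicedW n L θ p x y ≤ (1 / (L : ℝ) * (1 / (n : ℝ))) ^ (1 / p) *
      slicedCost θ p x y σ ^ (1 / p) := by
  rw [← Real.mul_rpow (by positivity) (slicedCost_nonneg θ p x y σ), mean_slicedCost_eq]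
  refine Real.rpow_le_rpow ?_ ?_ (by positivity)
  · exact mul_nonneg (by positivity) (Finset.sum_nonneg fun l _ =>
      Real.iInf_nonneg fun σ => by positivity)
  · gcongr with l
    exact ciInf_le (Set.finite_range _).bddBelow (σ l)

theorem exists_slicedW_eq_slicedCost : ∃ σ : Fin L → Equiv.Perm (Fin n),
    slicedW n L θ p x y = (1 / (L : ℝ) * (1 / (n : ℝ))) ^ (1 / p) *
      slicedCost θ p x y σ ^ (1 / p) := by
  choose σ hσ using fun l : Fin L => Set.Nonempty.csInf_mem (Set.range_nonempty
    fun σ : Equiv.Perm (Fin n) => 1 / (n : ℝ) * ∑ i : Fin n,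
      |⟪θ l, x i⟫ - ⟪θ l, y (σ i)⟫| ^ p) (Set.finite_range _)
  refine ⟨σ, ?_⟩
  rw [← Real.mul_rpow (by positivity) (slicedCost_nonneg θ p x y σ), mean_slicedCost_eq, slicedW]
  simp_rw [iInf, ← hσ]

theorem slicedW_nonneg : 0 ≤ slicedW n L θ p x y := by
  obtain ⟨σ, h⟩ := exists_slicedW_eq_slicedCost θ p x y
  have := slicedCost_nonneg θ p x y σ
  rw [h]
  positivity

theorem slicedW_comm : slicedW n L θ p x y = slicedW n L θ p y x := by
  unfold slicedW
  congr! 3 with l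
  refine Equiv.iInf_congr (Equiv.inv _) fun σ => ?_
  congr 1
  rw [← Equiv.sum_comp σ]
  simp [abs_sub_comm]

theorem slicedW_triangle {p : ℝ} (hp : 1 ≤ p) :
    slicedW n L θ p x z ≤ slicedW n L θ p x y + slicedW n L θ p y z := by
  obtain ⟨σ, hσ⟩ := exists_slicedW_eq_slicedCost θ p x y
  obtain ⟨τ, hτ⟩ := exists_slicedW_eq_slicedCost θ p y z
  refine (slicedW_le_slicedCost θ x z (zero_le_one.trans hp) fun l => τ l * σ l).trans ?_
  rw [hσ, hτ, ← mul_add]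
  gcongr
  have hreindex : slicedCost θ p y z τ = ∑ j : Fin L × Fin n,
      |⟪θ j.1, y (σ j.1 j.2)⟫ - ⟪θ j.1, z (τ j.1 (σ j.1 j.2))⟫| ^ p := by
    rw [slicedCost, Fintype.sum_prod_type, Fintype.sum_prod_type]
    exact Finset.sum_congr rfl fun l _ => (Equiv.sum_comp (σ l) _).symm
  rw [hreindex]
  refine le_trans ?_ (Real.Lp_add_le_of_nonneg Finset.univ hp
    (fun _ _ => abs_nonneg _) (fun _ _ => abs_nonneg _))
  refine Real.rpow_le_rpow (slicedCost_nonneg θ p x z _) ?_ (by positivity)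
  refine Finset.sum_le_sum fun j _ => ?_
  exact Real.rpow_le_rpow (abs_nonneg _) (abs_sub_le _ _ _) (by positivity)

theorem slicedW_eq_zero_iff {p : ℝ} (hn : 1 ≤ n) (hL : n + 1 ≤ L)
    (hncol : ∀ l k : Fin L, l ≠ k → LinearIndependent ℝ ![θ l, θ k]) (hp : 0 < p) :
    slicedW n L θ p x y = 0 ↔
      Multiset.map x Finset.univ.val = Multiset.map y Finset.univ.val := by
  constructor
  · intro h
    obtain ⟨σ, hσ⟩ := exists_slicedW_eq_slicedCost θ p x y
    have hc : (0 : ℝ) < (1 / (L : ℝ) * (1 / (n : ℝ))) ^ (1 / p) := by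
      have : 0 < L := by omega
      positivity
    rw [h, eq_comm, mul_eq_zero_iff_left hc.ne',
      Real.rpow_eq_zero (slicedCost_nonneg θ p x y σ) (by positivity),
      slicedCost_eq_zero_iff θ x y hp.ne'] at hσ
    refine Multiset.eq_of_forall_map_eq (fun l v => ⟪θ l, v⟫)
      (fun l k hlk a b => eq_of_inner_eq_of_linearIndependent (hncol l k hlk)) _ _
      (by simpa using hL) fun l => ?_
    rw [Multiset.map_map, Multiset.map_map, Multiset.map_univ_val_eq_iff_exists_perm]
    exact ⟨σ l, hσ l⟩
  · intro h
    obtain ⟨σ, hσ⟩ := (Multiset.map_univ_val_eq_iff_exists_perm x y).mp h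
    refine le_antisymm ?_ (slicedW_nonneg θ p x y)
    have hle := slicedW_le_slicedCost θ x y hp.le fun _ => σ
    rwa [(slicedCost_eq_zero_iff θ x y hp.ne' _).mpr fun l i => by rw [hσ i],
      Real.zero_rpow (by positivity), mul_zero] at hle

end slicedW

/-- Proposition 1: for `L ≥ n+1` pairwise non-collinear unit directions, the discrete
sliced-Wasserstein quantity is a distance on uniform discrete measures with `n` atoms:
nonnegative, symmetric, triangle inequality, and vanishing exactly when the multisets
of atoms coincide. -/
theorem sliced_wasserstein_is_distance
    (n L : ℕ) (hn : 1 ≤ n) (hL : n + 1 ≤ L)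
    (θ : Fin L → EuclideanSpace ℝ (Fin 2))
    (hunit : ∀ l : Fin L, ‖θ l‖ = 1)
    (hncol : ∀ l k : Fin L, l ≠ k → LinearIndependent ℝ ![θ l, θ k])
    (p : ℝ) (hp : 1 ≤ p) :
    (∀ x y : Fin n → EuclideanSpace ℝ (Fin 2), 0 ≤ slicedW n L θ p x y) ∧
    (∀ x y : Fin n → EuclideanSpace ℝ (Fin 2),
      slicedW n L θ p x y = slicedW n L θ p y x) ∧
    (∀ x y z : Fin n → EuclideanSpace ℝ (Fin 2),
      slicedW n L θ p x z ≤ slicedW n L θ p x y + slicedW n L θ p y z) ∧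
    (∀ x y : Fin n → EuclideanSpace ℝ (Fin 2),
      slicedW n L θ p x y = 0 ↔
        Multiset.map x Finset.univ.val = Multiset.map y Finset.univ.val) := by
  exact ⟨slicedW_nonneg θ p, slicedW_comm θ p, fun x y z => slicedW_triangle θ x y z hp,
    fun x y => slicedW_eq_zero_iff θ x y hn hL hncol (zero_lt_one.trans_le hp)⟩
end
end

section
/- Let n ≥ 1, L ≥ 1, and for l = 1, …, L let θ_l = (cos(π(l−1)/(2L)), sin(π(l−1)/(2L))) ∈ ℝ². For tuples x, y : Fin n → ℝ², define W_2(x, y) = ( min_{σ ∈ S_n} (1/n) Σ_{i=1}^n ‖x_i − y_{σ(i)}‖² )^{1/2} and ŜW_2(x, y) = ( (1/L) Σ_{l=1}^L min_{σ ∈ S_n} (1/n) Σ_{i=1}^n |⟪θ_l, x_i⟫ − ⟪θ_l, y_{σ(i)}⟫|² )^{1/2}. Then ŜW_2(x, y) ≤ sqrt( (1 + 1/(L·sin(π/(2L)))) / 2 ) · W_2(x, y). (Upper bound of Proposition 2, Equation (9).) -/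
open Real Finset
open scoped RealInnerProductSpace

noncomputable section

/-- Telescoped form of `∑ cos (2kh)` over `k < m`. -/
lemma two_mul_sin_mul_sum_cos (h : ℝ) (m : ℕ) :
    2 * Real.sin h * ∑ k ∈ range m, Real.cos (2 * k * h)
      = Real.sin ((2 * m - 1) * h) + Real.sin h := by
  induction m with
  | zero => simp
  | succ m ih =>
    rw [sum_range_succ, mul_add, ih]
    push_cast
    rw [show (2 * ((m : ℝ) + 1) - 1) * h = 2 * m * h + h by ring,
      show (2 * (m : ℝ) - 1) * h = 2 * m * h - h by ring, Real.sin_add, Real.sin_sub]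
    ring

/-- Telescoped form of `∑ sin (2kh)` over `k < m`. -/
lemma two_mul_sin_mul_sum_sin (h : ℝ) (m : ℕ) :
    2 * Real.sin h * ∑ k ∈ range m, Real.sin (2 * k * h)
      = Real.cos h - Real.cos ((2 * m - 1) * h) := by
  induction m with
  | zero => simp
  | succ m ih =>
    rw [sum_range_succ, mul_add, ih]
    push_cast
    rw [show (2 * ((m : ℝ) + 1) - 1) * h = 2 * m * h + h by ring,
      show (2 * (m : ℝ) - 1) * h = 2 * m * h - h by ring, Real.cos_add, Real.cos_sub]
    ring

/-- The quadratic form `(a² - b²) sin h + 2ab cos h` is bounded by the squared norm. -/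
lemma sq_sub_sq_mul_sin_add_le (a b h : ℝ) (hs : 0 < Real.sin h) :
    (a ^ 2 - b ^ 2) * Real.sin h + 2 * a * b * Real.cos h ≤ a ^ 2 + b ^ 2 := by
  have key : (1 + Real.sin h) *
      (a ^ 2 + b ^ 2 - ((a ^ 2 - b ^ 2) * Real.sin h + 2 * a * b * Real.cos h))
      = (a * Real.cos h - b * (1 + Real.sin h)) ^ 2 := by
    linear_combination -a ^ 2 * Real.sin_sq_add_cos_sq h
  have := nonneg_of_mul_nonneg_right (key ▸ sq_nonneg _) (by linarith : 0 < 1 + Real.sin h)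
  linarith

lemma sin_pi_div_two_mul_pos {L : ℕ} (hL : 1 ≤ L) : 0 < Real.sin (π / (2 * (L : ℝ))) := by
  have hL' : (1 : ℝ) ≤ L := by exact_mod_cast hL
  apply Real.sin_pos_of_pos_of_lt_pi (by positivity)
  rw [div_lt_iff₀ (by positivity)]
  nlinarith [Real.pi_pos]

/-- The frame bound for the quarter-circle grid of directions. -/
lemma sum_quarter_circle_projection_sq_le {L : ℕ} (hL : 1 ≤ L) (a b : ℝ) :
    ∑ k ∈ range L,
        (Real.cos (π * k / (2 * (L : ℝ))) * a + Real.sin (π * k / (2 * (L : ℝ))) * b) ^ 2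
      ≤ (L + 1 / Real.sin (π / (2 * (L : ℝ)))) / 2 * (a ^ 2 + b ^ 2) := by
  have hs := sin_pi_div_two_mul_pos hL
  have hL0 : (L : ℝ) ≠ 0 := by positivity
  set h := π / (2 * (L : ℝ)) with hh
  have hend : (2 * (L : ℝ) - 1) * h = π - h := by rw [hh]; field_simp
  have hcos := two_mul_sin_mul_sum_cos h L
  have hsin := two_mul_sin_mul_sum_sin h L
  rw [hend, Real.sin_pi_sub] at hcos
  rw [hend, Real.cos_pi_sub] at hsin
  have expand : ∑ k ∈ range L,
      (Real.cos (π * k / (2 * (L : ℝ))) * a + Real.sin (π * k / (2 * (L : ℝ))) * b) ^ 2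
      = L * ((a ^ 2 + b ^ 2) / 2) + (a ^ 2 - b ^ 2) / 2 * ∑ k ∈ range L, Real.cos (2 * k * h)
        + a * b * ∑ k ∈ range L, Real.sin (2 * k * h) := by
    rw [mul_sum, mul_sum, show (L : ℝ) * ((a ^ 2 + b ^ 2) / 2)
      = ∑ _k ∈ range L, (a ^ 2 + b ^ 2) / 2 by simp, ← sum_add_distrib, ← sum_add_distrib]
    refine sum_congr rfl fun k _ => ?_
    rw [show π * k / (2 * (L : ℝ)) = k * h by rw [hh]; ring,
      show 2 * (k : ℝ) * h = 2 * (k * h) by ring, Real.cos_two_mul, Real.sin_two_mul]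
    linear_combination b ^ 2 * Real.sin_sq_add_cos_sq (k * h)
  rw [expand]
  refine le_of_mul_le_mul_left ?_ hs
  have hr : Real.sin h * ((L + 1 / Real.sin h) / 2 * (a ^ 2 + b ^ 2))
      = (Real.sin h * L + 1) / 2 * (a ^ 2 + b ^ 2) := by
    field_simp
  rw [hr]
  linear_combination (a ^ 2 - b ^ 2) / 4 * hcos + a * b / 2 * hsin
    + sq_sub_sq_mul_sin_add_le a b h hs / 2

/-- Upper bound of Proposition 2 (Equation (9)): for the grid of `L` equally spaced
directions spanning a quarter circle, `θ_l = (cos(π(l−1)/(2L)), sin(π(l−1)/(2L)))`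
(here indexed by `l : Fin L`, so `(l : ℕ)` plays the role of `l−1`), the sliced-Wasserstein
distance of order 2 is bounded by `sqrt((1 + 1/(L sin(π/(2L))))/2)` times the
Wasserstein distance of order 2. -/
theorem sliced_wasserstein_upper_bound
    (n L : ℕ) (hn : 1 ≤ n) (hL : 1 ≤ L)
    (θ : Fin L → EuclideanSpace ℝ (Fin 2))
    (hθ : ∀ l : Fin L, θ l = (EuclideanSpace.equiv (Fin 2) ℝ).symm
      ![Real.cos (π * (l : ℕ) / (2 * (L : ℝ))), Real.sin (π * (l : ℕ) / (2 * (L : ℝ)))])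
    (x y : Fin n → EuclideanSpace ℝ (Fin 2)) :
    ((1 / (L : ℝ)) * ∑ l : Fin L, ⨅ σ : Equiv.Perm (Fin n),
        (1 / (n : ℝ)) * ∑ i : Fin n, |⟪θ l, x i⟫ - ⟪θ l, y (σ i)⟫| ^ 2) ^ ((1 : ℝ) / 2)
      ≤ Real.sqrt ((1 + 1 / ((L : ℝ) * Real.sin (π / (2 * (L : ℝ))))) / 2) *
        (⨅ σ : Equiv.Perm (Fin n),
          (1 / (n : ℝ)) * ∑ i : Fin n, ‖x i - y (σ i)‖ ^ 2) ^ ((1 : ℝ) / 2) := by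
  have hL0 : (0 : ℝ) < L := by exact_mod_cast hL
  have hs := sin_pi_div_two_mul_pos hL
  have frame (v : EuclideanSpace ℝ (Fin 2)) : (1 / (L : ℝ)) * ∑ l, ⟪θ l, v⟫ ^ 2
      ≤ (1 + 1 / ((L : ℝ) * Real.sin (π / (2 * (L : ℝ))))) / 2 * ‖v‖ ^ 2 := by
    have hb := sum_quarter_circle_projection_sq_le hL (v 0) (v 1)
    rw [← Fin.sum_univ_eq_sum_range (fun k : ℕ => (Real.cos (π * k / (2 * (L : ℝ))) * v 0
      + Real.sin (π * k / (2 * (L : ℝ))) * v 1) ^ 2)] at hb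
    have hsum : ∑ l, ⟪θ l, v⟫ ^ 2 = ∑ l : Fin L, (Real.cos (π * (l : ℕ) / (2 * (L : ℝ))) * v 0
        + Real.sin (π * (l : ℕ) / (2 * (L : ℝ))) * v 1) ^ 2 := by
      refine sum_congr rfl fun l _ => ?_
      rw [hθ, PiLp.inner_apply, Fin.sum_univ_two]
      simp [mul_comm]
    rw [EuclideanSpace.real_norm_sq_eq, Fin.sum_univ_two, hsum]
    calc _ ≤ _ := mul_le_mul_of_nonneg_left hb (by positivity)
      _ = _ := by field_simp
  obtain ⟨τ, hτ⟩ := exists_eq_ciInf_of_finite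
    (f := fun σ : Equiv.Perm (Fin n) => (1 / (n : ℝ)) * ∑ i, ‖x i - y (σ i)‖ ^ 2)
  rw [← hτ, ← Real.sqrt_eq_rpow, ← Real.sqrt_eq_rpow, ← Real.sqrt_mul (by positivity)]
  apply Real.sqrt_le_sqrt
  calc _ ≤ (1 / (L : ℝ)) * ∑ l, (1 / (n : ℝ)) * ∑ i, |⟪θ l, x i⟫ - ⟪θ l, y (τ i)⟫| ^ 2 := by
        gcongr with l
        exact ciInf_le (Set.finite_range _).bddBelow τ
    _ = (1 / (n : ℝ)) * ∑ i, (1 / (L : ℝ)) * ∑ l, ⟪θ l, x i - y (τ i)⟫ ^ 2 := by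
        simp_rw [sq_abs, ← inner_sub_right, ← mul_sum]
        rw [sum_comm]
        ring
    _ ≤ (1 / (n : ℝ)) * ∑ i, (1 + 1 / ((L : ℝ) * Real.sin (π / (2 * (L : ℝ))))) / 2
          * ‖x i - y (τ i)‖ ^ 2 := by
        exact mul_le_mul_of_nonneg_left (sum_le_sum fun i _ => frame _) (by positivity)
    _ = _ := by
        rw [← mul_sum]
        ring
end
end

section
/- Let n ≥ 1, L ≥ 1, and for l = 1, …, L let θ_l = (cos(π(l−1)/(2L)), sin(π(l−1)/(2L))) ∈ ℝ². Let x : Fin n → ℝ² be a tuple and y ∈ ℝ² a single point; let ȳ : Fin n → ℝ² be the constant tuple with all entries equal to y (so that ȳ represents the Dirac measure δ_y). Define W_2 and ŜW_2 as the permutation-minimum Wasserstein and grid sliced-Wasserstein distances of order 2 between tuples. Then ŜW_2(x, ȳ) ≥ sqrt( (1 − 1/(L·sin(π/(2L)))) / 2 ) · W_2(x, ȳ), where moreover W_2(x, ȳ) = ( (1/n) Σ_{i=1}^n ‖x_i − y‖² )^{1/2}. (Lower bound of Proposition 2, Equation (10), for the case ν = δ_y.) -/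
open Real Finset
open scoped RealInnerProductSpace

noncomputable section

/-- Telescoped form of the sum of squared projections on the directions of angle `l * φ`. -/
lemma two_mul_sin_mul_sum_sq_projection (a b φ : ℝ) (m : ℕ) :
    2 * Real.sin φ * ∑ l ∈ Finset.range m,
        (a * Real.cos (l * φ) + b * Real.sin (l * φ)) ^ 2 =
      m * Real.sin φ * (a ^ 2 + b ^ 2)
        + (a ^ 2 - b ^ 2) / 2 * (Real.sin (2 * (m * φ) - φ) + Real.sin φ)
        + a * b * (Real.cos φ - Real.cos (2 * (m * φ) - φ)) := by
  induction m with
  | zero => simp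
  | succ k ih =>
    have h : 2 * (((k + 1 : ℕ) : ℝ) * φ) - φ = 2 * (k * φ) + φ := by push_cast; ring
    rw [Finset.sum_range_succ, mul_add, ih, h, Real.sin_add, Real.sin_sub, Real.cos_add,
      Real.cos_sub, Real.sin_two_mul, Real.cos_two_mul]
    push_cast
    linear_combination (2 * Real.sin φ * b ^ 2) * Real.sin_sq_add_cos_sq (k * φ)

/-- The averaged squared projection on the quarter-circle grid is bounded below by a multiple
of the squared norm. -/
lemma sum_sq_projection_grid_lower_bound (a b : ℝ) (L : ℕ) (hL : 1 ≤ L) :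
    (1 - 1 / ((L : ℝ) * Real.sin (π / (2 * (L : ℝ))))) / 2 * (a ^ 2 + b ^ 2) ≤
      1 / (L : ℝ) * ∑ l : Fin L,
        (a * Real.cos (π * (l : ℕ) / (2 * (L : ℝ)))
          + b * Real.sin (π * (l : ℕ) / (2 * (L : ℝ)))) ^ 2 := by
  have hL1 : (1 : ℝ) ≤ L := by exact_mod_cast hL
  have hL0 : (0 : ℝ) < L := by linarith
  set φ := π / (2 * (L : ℝ)) with hφ
  have hangle : ∀ l : ℕ, π * (l : ℝ) / (2 * (L : ℝ)) = l * φ := fun l => by rw [hφ]; ring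
  simp only [hangle]
  rw [Fin.sum_univ_eq_sum_range
    (fun l : ℕ => (a * Real.cos (l * φ) + b * Real.sin (l * φ)) ^ 2) L]
  have hs : 0 < Real.sin φ := by
    apply Real.sin_pos_of_pos_of_lt_pi (by positivity)
    rw [hφ, div_lt_iff₀ (by positivity)]
    nlinarith [Real.pi_pos]
  have hend : 2 * ((L : ℝ) * φ) - φ = π - φ := by rw [hφ]; field_simp
  have hsum := two_mul_sin_mul_sum_sq_projection a b φ L
  rw [hend, Real.sin_pi_sub, Real.cos_pi_sub] at hsum
  set S := ∑ l ∈ Finset.range L, (a * Real.cos (l * φ) + b * Real.sin (l * φ)) ^ 2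
  have hquad : 0 ≤ (a ^ 2 + b ^ 2) + Real.sin φ * (a ^ 2 - b ^ 2) + 2 * a * b * Real.cos φ := by
    refine nonneg_of_mul_nonneg_right (a := 1 + Real.sin φ) ?_ (by linarith)
    have hsq := sq_nonneg ((1 + Real.sin φ) * a + Real.cos φ * b)
    linear_combination hsq + b ^ 2 * Real.sin_sq_add_cos_sq φ
  have hlhs : (1 - 1 / ((L : ℝ) * Real.sin φ)) / 2 * (a ^ 2 + b ^ 2) =
      (L * Real.sin φ * (a ^ 2 + b ^ 2) - (a ^ 2 + b ^ 2)) / (2 * L * Real.sin φ) := by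
    field_simp
  have hrhs : 1 / (L : ℝ) * S = (2 * Real.sin φ * S) / (2 * L * Real.sin φ) := by
    field_simp
  rw [hlhs, hrhs, hsum]
  gcongr
  linarith

/-- Lower bound of Proposition 2 (Equation (10)) for the Dirac case `ν = δ_y`: for the
quarter-circle grid of directions, the sliced-Wasserstein distance of order 2 between a
tuple `x` and the constant tuple `ȳ` is at least `sqrt((1 − 1/(L sin(π/(2L))))/2)` times
the Wasserstein distance, and moreover the Wasserstein distance to the Dirac measure is
`((1/n) Σ_i ‖x_i − y‖²)^{1/2}`. -/
theorem sliced_wasserstein_lower_bound_dirac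
    (n L : ℕ) (hn : 1 ≤ n) (hL : 1 ≤ L)
    (θ : Fin L → EuclideanSpace ℝ (Fin 2))
    (hθ : ∀ l : Fin L, θ l = (EuclideanSpace.equiv (Fin 2) ℝ).symm
      ![Real.cos (π * (l : ℕ) / (2 * (L : ℝ))), Real.sin (π * (l : ℕ) / (2 * (L : ℝ)))])
    (x : Fin n → EuclideanSpace ℝ (Fin 2)) (y : EuclideanSpace ℝ (Fin 2))
    (ybar : Fin n → EuclideanSpace ℝ (Fin 2)) (hybar : ybar = fun _ => y) :
    ((1 / (L : ℝ)) * ∑ l : Fin L, ⨅ σ : Equiv.Perm (Fin n),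
        (1 / (n : ℝ)) * ∑ i : Fin n, |⟪θ l, x i⟫ - ⟪θ l, ybar (σ i)⟫| ^ 2) ^ ((1 : ℝ) / 2)
      ≥ Real.sqrt ((1 - 1 / ((L : ℝ) * Real.sin (π / (2 * (L : ℝ))))) / 2) *
        (⨅ σ : Equiv.Perm (Fin n),
          (1 / (n : ℝ)) * ∑ i : Fin n, ‖x i - ybar (σ i)‖ ^ 2) ^ ((1 : ℝ) / 2)
    ∧ (⨅ σ : Equiv.Perm (Fin n),
          (1 / (n : ℝ)) * ∑ i : Fin n, ‖x i - ybar (σ i)‖ ^ 2) ^ ((1 : ℝ) / 2)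
        = ((1 / (n : ℝ)) * ∑ i : Fin n, ‖x i - y‖ ^ 2) ^ ((1 : ℝ) / 2) := by
  subst hybar
  simp only [ciInf_const, and_true, ge_iff_le]
  have hpoint : ∀ i, (1 - 1 / ((L : ℝ) * Real.sin (π / (2 * (L : ℝ))))) / 2 * ‖x i - y‖ ^ 2 ≤
      1 / (L : ℝ) * ∑ l : Fin L, |⟪θ l, x i⟫ - ⟪θ l, y⟫| ^ 2 := by
    intro i
    convert sum_sq_projection_grid_lower_bound ((x i - y) 0) ((x i - y) 1) L hL using 2
    · simp [EuclideanSpace.norm_sq_eq, Fin.sum_univ_two]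
    · refine Finset.sum_congr rfl fun l _ => ?_
      rw [sq_abs, ← inner_sub_right, hθ l]
      simp [PiLp.inner_apply, Fin.sum_univ_two]
  have hswap : (1 - 1 / ((L : ℝ) * Real.sin (π / (2 * (L : ℝ))))) / 2 *
        (1 / (n : ℝ) * ∑ i, ‖x i - y‖ ^ 2) ≤
      1 / (L : ℝ) * ∑ l : Fin L, 1 / (n : ℝ) * ∑ i, |⟪θ l, x i⟫ - ⟪θ l, y⟫| ^ 2 := by
    calc _ = 1 / (n : ℝ) * ∑ i,
          (1 - 1 / ((L : ℝ) * Real.sin (π / (2 * (L : ℝ))))) / 2 * ‖x i - y‖ ^ 2 := by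
          rw [← Finset.mul_sum]; ring
      _ ≤ 1 / (n : ℝ) * ∑ i, 1 / (L : ℝ) * ∑ l : Fin L, |⟪θ l, x i⟫ - ⟪θ l, y⟫| ^ 2 := by
          exact mul_le_mul_of_nonneg_left (Finset.sum_le_sum fun i _ => hpoint i) (by positivity)
      _ = _ := by
          rw [← Finset.mul_sum, ← Finset.mul_sum, Finset.sum_comm]; ring
  rw [← Real.sqrt_eq_rpow, ← Real.sqrt_eq_rpow, ← Real.sqrt_mul' _ (by positivity)]
  exact Real.sqrt_le_sqrt hswap
end
end

section
/- Let n ≥ 1, L ≥ 1, let θ_1, …, θ_L be vectors in ℝ², and let ρ ≥ 0 be a real number such that Σ_{l=1}^L ⟪θ_l, v⟫² ≤ ρ ‖v‖² for every v ∈ ℝ² (i.e., ρ bounds the largest eigenvalue of Θ = Σ_l θ_l θ_lᵀ). Then for all tuples x, y : Fin n → ℝ², the sliced-Wasserstein distance satisfies ŜW_2(x, y)² ≤ (ρ/L) · W_2(x, y)², where W_2(x, y)² = min_{σ ∈ S_n} (1/n) Σ_i ‖x_i − y_{σ(i)}‖² and ŜW_2(x, y)² = (1/L) Σ_{l=1}^L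 min_{σ ∈ S_n} (1/n) Σ_i |⟪θ_l, x_i⟫ − ⟪θ_l, y_{σ(i)}⟫|². (Intermediate spectral bound in the proof of Proposition 2.) -/
open Real Finset
open scoped RealInnerProductSpace

noncomputable section

/-- Intermediate spectral bound in the proof of Proposition 2: if `ρ ≥ 0` satisfies
`Σ_l ⟪θ_l, v⟫² ≤ ρ‖v‖²` for every `v` (i.e. `ρ` bounds the largest eigenvalue of
`Θ = Σ_l θ_l θ_lᵀ`), then `ŜW₂(x,y)² ≤ (ρ/L)·W₂(x,y)²`. -/
theorem sliced_wasserstein_spectral_upper_bound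
    (n L : ℕ) (hn : 1 ≤ n) (hL : 1 ≤ L)
    (θ : Fin L → EuclideanSpace ℝ (Fin 2))
    (ρ : ℝ) (hρ : 0 ≤ ρ)
    (hbound : ∀ v : EuclideanSpace ℝ (Fin 2),
      (∑ l : Fin L, ⟪θ l, v⟫ ^ 2) ≤ ρ * ‖v‖ ^ 2)
    (x y : Fin n → EuclideanSpace ℝ (Fin 2)) :
    ((1 / (L : ℝ)) * ∑ l : Fin L, ⨅ σ : Equiv.Perm (Fin n),
        (1 / (n : ℝ)) * ∑ i : Fin n, |⟪θ l, x i⟫ - ⟪θ l, y (σ i)⟫| ^ 2)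
      ≤ (ρ / (L : ℝ)) *
        ⨅ σ : Equiv.Perm (Fin n), (1 / (n : ℝ)) * ∑ i : Fin n, ‖x i - y (σ i)‖ ^ 2 := by
  obtain ⟨σ, hσ⟩ := exists_eq_ciInf_of_finite
    (f := fun σ : Equiv.Perm (Fin n) => (1 / (n : ℝ)) * ∑ i : Fin n, ‖x i - y (σ i)‖ ^ 2)
  rw [← hσ, div_eq_mul_one_div ρ, mul_comm ρ, mul_assoc]
  refine mul_le_mul_of_nonneg_left ?_ (by positivity)
  calc
    _ ≤ ∑ l : Fin L, (1 / (n : ℝ)) * ∑ i : Fin n, |⟪θ l, x i⟫ - ⟪θ l, y (σ i)⟫| ^ 2 :=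
      sum_le_sum fun _ _ => ciInf_le (Set.finite_range _).bddBelow σ
    _ = (1 / (n : ℝ)) * ∑ i : Fin n, ∑ l : Fin L, ⟪θ l, x i - y (σ i)⟫ ^ 2 := by
      rw [← mul_sum, sum_comm]
      simp only [sq_abs, inner_sub_right]
    _ ≤ (1 / (n : ℝ)) * ∑ i : Fin n, ρ * ‖x i - y (σ i)‖ ^ 2 := by
      gcongr with i
      exact hbound _
    _ = ρ * ((1 / (n : ℝ)) * ∑ i : Fin n, ‖x i - y (σ i)‖ ^ 2) := by
      rw [← mul_sum, mul_left_comm]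
end
end

section
/- Let n ≥ 1, L ≥ 1, let θ_1, …, θ_L be vectors in ℝ², and let γ ≥ 0 be a real number such that Σ_{l=1}^L ⟪θ_l, v⟫² ≥ γ ‖v‖² for every v ∈ ℝ² (i.e., γ is a lower bound for the smallest eigenvalue of Θ = Σ_l θ_l θ_lᵀ). Let x : Fin n → ℝ² be a tuple and y ∈ ℝ², and let ȳ be the constant tuple with all entries y. Then ŜW_2(x, ȳ)² ≥ (γ/L) · (1/n) Σ_{i=1}^n ‖x_i − y‖², where ŜW_2(x, ȳ)² = (1/L) Σ_{l=1}^L min_{σ ∈ S_n} (1/n) Σ_i |⟪θ_l, x_i⟫ − ⟪θ_l, y⟫|². (Intermediate spectral lower bound in the proof of Proposition 2 for the Dirac case.) -/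
open Real Finset
open scoped RealInnerProductSpace

noncomputable section

/-- Intermediate spectral lower bound in the proof of Proposition 2 for the Dirac case:
if `γ ≥ 0` satisfies `Σ_l ⟪θ_l, v⟫² ≥ γ‖v‖²` for every `v` (i.e. `γ` is a lower bound
for the smallest eigenvalue of `Θ = Σ_l θ_l θ_lᵀ`), then
`ŜW₂(x, ȳ)² ≥ (γ/L)·(1/n)Σ_i ‖x_i − y‖²` for the constant tuple `ȳ`. -/
theorem sliced_wasserstein_spectral_lower_bound_dirac
    (n L : ℕ) (hn : 1 ≤ n) (hL : 1 ≤ L)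
    (θ : Fin L → EuclideanSpace ℝ (Fin 2))
    (γ : ℝ) (hγ : 0 ≤ γ)
    (hbound : ∀ v : EuclideanSpace ℝ (Fin 2),
      γ * ‖v‖ ^ 2 ≤ ∑ l : Fin L, ⟪θ l, v⟫ ^ 2)
    (x : Fin n → EuclideanSpace ℝ (Fin 2)) (y : EuclideanSpace ℝ (Fin 2))
    (ybar : Fin n → EuclideanSpace ℝ (Fin 2)) (hybar : ybar = fun _ => y) :
    (γ / (L : ℝ)) * ((1 / (n : ℝ)) * ∑ i : Fin n, ‖x i - y‖ ^ 2)
      ≤ (1 / (L : ℝ)) * ∑ l : Fin L, ⨅ σ : Equiv.Perm (Fin n),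
          (1 / (n : ℝ)) * ∑ i : Fin n, |⟪θ l, x i⟫ - ⟪θ l, ybar (σ i)⟫| ^ 2 := by
  subst hybar
  simp only [ciInf_const, sq_abs, ← inner_sub_right]
  have hsum : γ * ∑ i, ‖x i - y‖ ^ 2 ≤ ∑ l, ∑ i, ⟪θ l, x i - y⟫ ^ 2 := by
    rw [mul_sum, sum_comm]
    exact sum_le_sum fun i _ => hbound (x i - y)
  calc (γ / (L : ℝ)) * ((1 / (n : ℝ)) * ∑ i, ‖x i - y‖ ^ 2)
      = (1 / (L : ℝ)) * ((1 / (n : ℝ)) * (γ * ∑ i, ‖x i - y‖ ^ 2)) := by ring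
    _ ≤ (1 / (L : ℝ)) * ((1 / (n : ℝ)) * ∑ l, ∑ i, ⟪θ l, x i - y⟫ ^ 2) := by gcongr
    _ = _ := by rw [mul_sum univ]
end
end

section
/- Let n ≥ 2, and suppose the following induction hypothesis step holds: let θ_1, …, θ_L be pairwise non-collinear unit vectors in ℝ² with L ≥ n+1, and let x, y : Fin n → ℝ² be tuples such that for every l ≤ L the multisets {⟪θ_l, x_i⟫ : i ≤ n} and {⟪θ_l, y_i⟫ : i ≤ n} coincide. Then there exists an index j ≤ n with x_n = y_j; that is, some atom of the first tuple appears among the atoms of the second. (Pigeonhole step of the induction in the proof of Proposition 1: since L ≥ n+1, two distinct directions θ_l, θ_k must match the projection of x_n to the projection of the same atom y_j, and non-collinearity forces x_n = y_j.) -/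
open Real Finset
open scoped RealInnerProductSpace

noncomputable section

/-- In a finite-dimensional real inner product space, a vector is determined by its inner products
with a linearly independent family of as many vectors as the dimension. -/
theorem LinearIndependent.eq_of_forall_inner_eq {ι E : Type*} [Fintype ι] [Nonempty ι]
    [NormedAddCommGroup E] [InnerProductSpace ℝ E] {b : ι → E} (hb : LinearIndependent ℝ b)
    (hcard : Fintype.card ι = Module.finrank ℝ E) {u v : E}
    (h : ∀ i, ⟪b i, u⟫ = ⟪b i, v⟫) : u = v :=
  InnerProductSpace.ext_inner_left_basis
    (basisOfLinearIndependentOfCardEqFinrank hb hcard) fun i => by simpa using h i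

/-- Pigeonhole step of the induction in the proof of Proposition 1: with `L ≥ n+1`
pairwise non-collinear unit directions and tuples whose multisets of projections coincide
in every direction, some atom of the first tuple (here its last entry, playing the role
of `x_n`) appears among the atoms of the second tuple. -/
theorem pigeonhole_step_atom_match
    (n L : ℕ) (hn : 2 ≤ n) (hL : n + 1 ≤ L)
    (θ : Fin L → EuclideanSpace ℝ (Fin 2))
    (hunit : ∀ l : Fin L, ‖θ l‖ = 1)
    (hncol : ∀ l k : Fin L, l ≠ k → LinearIndependent ℝ ![θ l, θ k])
    (x y : Fin n → EuclideanSpace ℝ (Fin 2))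
    (hproj : ∀ l : Fin L,
      Multiset.map (fun i => ⟪θ l, x i⟫) Finset.univ.val =
      Multiset.map (fun i => ⟪θ l, y i⟫) Finset.univ.val) :
    ∃ j : Fin n, x ⟨n - 1, by omega⟩ = y j := by
  set a := x ⟨n - 1, by omega⟩
  have hmatch : ∀ l, ∃ j, ⟪θ l, y j⟫ = ⟪θ l, a⟫ := fun l => by
    have hmem : ⟪θ l, a⟫ ∈ Multiset.map (fun i => ⟪θ l, y i⟫) Finset.univ.val := by
      rw [← hproj l]
      exact Multiset.mem_map_of_mem (fun i => ⟪θ l, x i⟫) (Finset.mem_univ_val _)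
    simpa using hmem
  choose f hf using hmatch
  obtain ⟨l, k, hlk, hfl⟩ := Fintype.exists_ne_map_eq_of_card_lt f (by simpa using hL)
  refine ⟨f l, (hncol l k hlk).eq_of_forall_inner_eq (by simp) fun i => ?_⟩
  fin_cases i
  · exact (hf l).symm
  · simpa [hfl] using (hf k).symm
end
end
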